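/- arXiv:2006.14616 — 5 statements merged into one kernel-verified Lean document; each statement's English description precedes it below -/
import Mathlib

section
/- Let n be a positive integer and let M be a real n×n matrix with singular value decomposition M = U Σ Vᵀ, where U and V are orthogonal n×n matrices and Σ is a diagonal matrix with nonnegative diagonal entries. Then for every orthogonal n×n matrix R, ‖U Vᵀ − M‖_F ≤ ‖R − M‖_F, i.e. U Vᵀ minimizes the Frobenius distance to M over the orthogonal group O(n). -/
open Matrix

/-- The Frobenius norm of a real square matrix: the square root of the sum of
squares of its entries. -/
noncomputable def frobNorm {n : ℕ} (M : Matrix (Fin n) (Fin n) ℝ) : ℝ :=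
  Real.sqrt (∑ i, ∑ j, (M i j) ^ 2)

/-- The squared Frobenius norm is the trace of the Gram matrix. -/
theorem sum_sq_entries_eq_trace {n : ℕ} (A : Matrix (Fin n) (Fin n) ℝ) :
    ∑ i, ∑ j, (A i j) ^ 2 = (Aᵀ * A).trace := by
  rw [Finset.sum_comm]
  simp [Matrix.trace, Matrix.mul_apply, sq]

theorem diag_le_one_of_orthogonal {n : ℕ} {W : Matrix (Fin n) (Fin n) ℝ}
    (hW : Wᵀ * W = 1) (i : Fin n) : W i i ≤ 1 := by
  have hmem : W ∈ Matrix.unitaryGroup (Fin n) ℝ :=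
    Matrix.mem_unitaryGroup_iff'.mpr hW
  exact (le_abs_self _).trans (entry_norm_bound_of_unitary hmem i i)

theorem trace_gram_sub_of_orthogonal {n : ℕ} {R : Matrix (Fin n) (Fin n) ℝ}
    (hR : Rᵀ * R = 1) (M : Matrix (Fin n) (Fin n) ℝ) :
    ((R - M)ᵀ * (R - M)).trace = n - 2 * (Rᵀ * M).trace + (Mᵀ * M).trace := by
  have hcross : (Mᵀ * R).trace = (Rᵀ * M).trace := by
    rw [← Matrix.trace_transpose, Matrix.transpose_mul, Matrix.transpose_transpose]
  rw [Matrix.transpose_sub, Matrix.sub_mul, Matrix.mul_sub, Matrix.mul_sub, hR]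
  simp only [Matrix.trace_sub, hcross, Matrix.trace_one, Fintype.card_fin]
  ring

theorem trace_transpose_mul_svd {n : ℕ} (R U V : Matrix (Fin n) (Fin n) ℝ) (d : Fin n → ℝ) :
    (Rᵀ * (U * Matrix.diagonal d * Vᵀ)).trace = ∑ i, (Vᵀ * Rᵀ * U) i i * d i := by
  rw [← Matrix.mul_assoc, Matrix.trace_mul_comm, ← Matrix.mul_assoc, ← Matrix.mul_assoc]
  simp only [Matrix.trace, Matrix.diag_apply, Matrix.mul_diagonal]

/-- **Least-squares optimality of symmetric (SVD) orthogonalization.**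
If `M = U Σ Vᵀ` with `U, V` orthogonal and `Σ` diagonal with nonnegative
entries, then `U Vᵀ` minimizes the Frobenius distance to `M` over the
orthogonal group `O(n)`. -/
theorem svd_orthogonalization_minimizes (n : ℕ) (hn : 0 < n)
    (M U V : Matrix (Fin n) (Fin n) ℝ) (d : Fin n → ℝ)
    (hd : ∀ i, 0 ≤ d i)
    (hU : Uᵀ * U = 1) (hV : Vᵀ * V = 1)
    (hM : M = U * Matrix.diagonal d * Vᵀ) :
    ∀ R : Matrix (Fin n) (Fin n) ℝ, Rᵀ * R = 1 →
      frobNorm (U * Vᵀ - M) ≤ frobNorm (R - M) := by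
  intro R hR
  have hVV : V * Vᵀ = 1 := mul_eq_one_comm.mp hV
  have hRR : R * Rᵀ = 1 := mul_eq_one_comm.mp hR
  have hUV : (U * Vᵀ)ᵀ * (U * Vᵀ) = 1 := by
    rw [Matrix.transpose_mul, Matrix.transpose_transpose, Matrix.mul_assoc,
      ← Matrix.mul_assoc Uᵀ, hU, Matrix.one_mul, hVV]
  have hW : (Vᵀ * Rᵀ * U)ᵀ * (Vᵀ * Rᵀ * U) = 1 := by
    calc (Vᵀ * Rᵀ * U)ᵀ * (Vᵀ * Rᵀ * U) = Uᵀ * (R * (V * Vᵀ) * Rᵀ) * U := by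
          simp only [Matrix.transpose_mul, Matrix.transpose_transpose, Matrix.mul_assoc]
      _ = 1 := by rw [hVV, Matrix.mul_one, hRR, Matrix.mul_one, hU]
  have hWUV : Vᵀ * (U * Vᵀ)ᵀ * U = 1 := by
    rw [Matrix.transpose_mul, Matrix.transpose_transpose, ← Matrix.mul_assoc, hV,
      Matrix.one_mul, hU]
  have htrace : (Rᵀ * M).trace ≤ ((U * Vᵀ)ᵀ * M).trace := by
    rw [hM, trace_transpose_mul_svd, trace_transpose_mul_svd, hWUV]
    refine Finset.sum_le_sum fun i _ => ?_
    rw [Matrix.one_apply_eq]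
    exact mul_le_mul_of_nonneg_right (diag_le_one_of_orthogonal hW i) (hd i)
  refine Real.sqrt_le_sqrt ?_
  rw [sum_sq_entries_eq_trace, sum_sq_entries_eq_trace, trace_gram_sub_of_orthogonal hUV,
    trace_gram_sub_of_orthogonal hR]
  linarith
end

section
/- Let n be a positive integer and let M be a real n×n matrix with singular value decomposition M = U Σ Vᵀ, where U and V are orthogonal n×n matrices and Σ is a diagonal matrix all of whose diagonal entries are strictly positive (so M is invertible). If R is an orthogonal n×n matrix with ‖R − M‖_F = ‖U Vᵀ − M‖_F, then R = U Vᵀ; that is, the minimizer of the Frobenius distance to M over O(n) is unique and equal to U Vᵀ. -/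
open Matrix

theorem frobNorm_eq_sqrt_trace {n : ℕ} (A : Matrix (Fin n) (Fin n) ℝ) :
    frobNorm A = Real.sqrt (Aᵀ * A).trace := by
  rw [frobNorm, Finset.sum_comm]
  simp [Matrix.trace, Matrix.mul_apply, sq]

theorem trace_transpose_mul_self_nonneg {n : ℕ} (A : Matrix (Fin n) (Fin n) ℝ) :
    0 ≤ (Aᵀ * A).trace := by
  simp only [Matrix.trace, Matrix.diag_apply, Matrix.mul_apply, Matrix.transpose_apply]
  exact Finset.sum_nonneg fun _ _ => Finset.sum_nonneg fun _ _ => mul_self_nonneg _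

/-- Two orthogonal matrices at the same Frobenius distance from `M` have the same inner product
with `M`. -/
theorem trace_transpose_mul_eq_of_frobNorm_sub_eq {n : ℕ} {M Q R : Matrix (Fin n) (Fin n) ℝ}
    (hQ : Qᵀ * Q = 1) (hR : Rᵀ * R = 1) (h : frobNorm (R - M) = frobNorm (Q - M)) :
    (Mᵀ * R).trace = (Mᵀ * Q).trace := by
  have expand : ∀ A : Matrix (Fin n) (Fin n) ℝ, Aᵀ * A = 1 →
      ((A - M)ᵀ * (A - M)).trace = n - 2 * (Mᵀ * A).trace + (Mᵀ * M).trace := by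
    intro A hA
    have hAM : (Aᵀ * M).trace = (Mᵀ * A).trace := by
      rw [← Matrix.trace_transpose, Matrix.transpose_mul, Matrix.transpose_transpose]
    rw [Matrix.transpose_sub, Matrix.sub_mul, Matrix.mul_sub, Matrix.mul_sub, hA]
    simp only [Matrix.trace_sub, Matrix.trace_one, Fintype.card_fin, hAM]
    ring
  rw [frobNorm_eq_sqrt_trace, frobNorm_eq_sqrt_trace,
    Real.sqrt_inj (trace_transpose_mul_self_nonneg _) (trace_transpose_mul_self_nonneg _),
    expand R hR, expand Q hQ] at h
  linarith

theorem sum_sq_sub_one_of_orthogonal {n : ℕ} {W : Matrix (Fin n) (Fin n) ℝ}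
    (hW : Wᵀ * W = 1) (j : Fin n) :
    ∑ i, (W i j - (1 : Matrix (Fin n) (Fin n) ℝ) i j) ^ 2 = 2 * (1 - W j j) := by
  have hcol : ∑ i, W i j ^ 2 = 1 := by
    simpa [Matrix.mul_apply, sq] using congrFun (congrFun hW j) j
  simp only [sub_sq, Finset.sum_add_distrib, Finset.sum_sub_distrib, hcol, Matrix.one_apply]
  simp
  ring

/-- For a positive diagonal weight, the identity is the only orthogonal matrix whose weighted
trace is the sum of the weights. -/
theorem eq_one_of_orthogonal_of_sum_mul_diag_eq {n : ℕ} {W : Matrix (Fin n) (Fin n) ℝ}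
    {d : Fin n → ℝ} (hd : ∀ i, 0 < d i) (hW : Wᵀ * W = 1)
    (h : ∑ i, d i * W i i = ∑ i, d i) : W = 1 := by
  have hcol := sum_sq_sub_one_of_orthogonal hW
  have hle : ∀ j, W j j ≤ 1 := fun j => by
    have := Finset.sum_nonneg fun i (_ : i ∈ Finset.univ) =>
      sq_nonneg (W i j - (1 : Matrix (Fin n) (Fin n) ℝ) i j)
    linarith [hcol j]
  have hdiag := (Finset.sum_eq_sum_iff_of_le fun i _ =>
    mul_le_of_le_one_right (hd i).le (hle i)).1 h
  ext i j
  have hjj : W j j = 1 := (mul_eq_left₀ (hd j).ne').1 (hdiag j (Finset.mem_univ j))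
  have hzero := hcol j
  rw [hjj, sub_self, mul_zero, Finset.sum_eq_zero_iff_of_nonneg fun _ _ => sq_nonneg _] at hzero
  exact sub_eq_zero.1 (pow_eq_zero_iff two_ne_zero |>.1 (hzero i (Finset.mem_univ i)))

theorem trace_svd_transpose_mul {n : ℕ} (U V Q : Matrix (Fin n) (Fin n) ℝ) (d : Fin n → ℝ) :
    ((U * Matrix.diagonal d * Vᵀ)ᵀ * Q).trace = ∑ i, d i * (Uᵀ * Q * V) i i := by
  rw [Matrix.transpose_mul, Matrix.transpose_mul, Matrix.transpose_transpose,
    Matrix.diagonal_transpose, Matrix.mul_assoc, Matrix.trace_mul_comm, Matrix.mul_assoc,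
    Matrix.mul_assoc, ← Matrix.mul_assoc Uᵀ]
  simp [Matrix.trace, Matrix.diagonal_mul]

/-- **Uniqueness of the nearest orthogonal matrix for invertible `M`.**
If `M = U Σ Vᵀ` with `U, V` orthogonal and `Σ` diagonal with strictly positive
entries, and an orthogonal matrix `R` attains the same Frobenius distance to
`M` as `U Vᵀ` does, then `R = U Vᵀ`. -/
theorem svd_orthogonalization_unique (n : ℕ) (hn : 0 < n)
    (M U V : Matrix (Fin n) (Fin n) ℝ) (d : Fin n → ℝ)
    (hd : ∀ i, 0 < d i)
    (hU : Uᵀ * U = 1) (hV : Vᵀ * V = 1)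
    (hM : M = U * Matrix.diagonal d * Vᵀ)
    (R : Matrix (Fin n) (Fin n) ℝ) (hR : Rᵀ * R = 1)
    (heq : frobNorm (R - M) = frobNorm (U * Vᵀ - M)) :
    R = U * Vᵀ := by
  have hU' : U * Uᵀ = 1 := mul_eq_one_comm.1 hU
  have hV' : V * Vᵀ = 1 := mul_eq_one_comm.1 hV
  have hQ : (U * Vᵀ)ᵀ * (U * Vᵀ) = 1 := by
    rw [Matrix.transpose_mul, Matrix.transpose_transpose, Matrix.mul_assoc,
      ← Matrix.mul_assoc Uᵀ, hU, Matrix.one_mul, hV']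
  have hW : (Uᵀ * R * V)ᵀ * (Uᵀ * R * V) = 1 := by
    calc (Uᵀ * R * V)ᵀ * (Uᵀ * R * V) = Vᵀ * (Rᵀ * (U * Uᵀ) * R) * V := by
          simp only [Matrix.transpose_mul, Matrix.transpose_transpose, Matrix.mul_assoc]
      _ = 1 := by rw [hU', Matrix.mul_one, hR, Matrix.mul_one, hV]
  have hQW : Uᵀ * (U * Vᵀ) * V = 1 := by
    rw [← Matrix.mul_assoc, hU, Matrix.one_mul, hV]
  have htr := trace_transpose_mul_eq_of_frobNorm_sub_eq hQ hR heq
  rw [hM, trace_svd_transpose_mul, trace_svd_transpose_mul, hQW] at htr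
  have hone : Uᵀ * R * V = 1 :=
    eq_one_of_orthogonal_of_sum_mul_diag_eq hd hW (by simpa using htr)
  calc R = (U * Uᵀ) * R * (V * Vᵀ) := by rw [hU', hV', Matrix.one_mul, Matrix.mul_one]
    _ = U * (Uᵀ * R * V) * Vᵀ := by simp only [Matrix.mul_assoc]
    _ = U * Vᵀ := by rw [hone, Matrix.mul_one]
end

section
/- Let n be a positive integer and let M be a real n×n matrix with singular value decomposition M = U Σ Vᵀ, where U and V are orthogonal n×n matrices and Σ is a diagonal matrix with nonnegative diagonal entries. Then for every orthogonal n×n matrix R, trace(Mᵀ R) ≤ trace(Σ). -/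
open Matrix

/-- The trace of a nonnegative diagonal matrix does not increase under multiplication by an
orthogonal matrix. -/
theorem trace_diagonal_mul_le_of_mem_orthogonalGroup {m : Type*} [Fintype m] [DecidableEq m]
    {d : m → ℝ} (hd : ∀ i, 0 ≤ d i) {Z : Matrix m m ℝ} (hZ : Z ∈ Matrix.orthogonalGroup m ℝ) :
    (Matrix.diagonal d * Z).trace ≤ (Matrix.diagonal d).trace := by
  simp only [Matrix.trace, Matrix.diag_apply, Matrix.diagonal_mul, Matrix.diagonal_apply_eq]
  refine Finset.sum_le_sum fun i _ => mul_le_of_le_one_right (hd i) ?_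
  exact (le_abs_self _).trans (entry_norm_bound_of_unitary hZ i i)

/-- **Trace bound for the orthogonal Procrustes problem.**
If `M = U Σ Vᵀ` with `U, V` orthogonal and `Σ` diagonal with nonnegative
entries, then for every orthogonal `R`, `trace (Mᵀ R) ≤ trace Σ`. -/
theorem trace_le_trace_singular_values (n : ℕ) (hn : 0 < n)
    (M U V : Matrix (Fin n) (Fin n) ℝ) (d : Fin n → ℝ)
    (hd : ∀ i, 0 ≤ d i)
    (hU : Uᵀ * U = 1) (hV : Vᵀ * V = 1)
    (hM : M = U * Matrix.diagonal d * Vᵀ) :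
    ∀ R : Matrix (Fin n) (Fin n) ℝ, Rᵀ * R = 1 →
      (Mᵀ * R).trace ≤ (Matrix.diagonal d).trace := by
  intro R hR
  have hU' : Uᵀ ∈ Matrix.orthogonalGroup (Fin n) ℝ :=
    Unitary.star_mem ((Matrix.mem_orthogonalGroup_iff' _ _).mpr hU)
  have hV' : V ∈ Matrix.orthogonalGroup (Fin n) ℝ := (Matrix.mem_orthogonalGroup_iff' _ _).mpr hV
  have hR' : R ∈ Matrix.orthogonalGroup (Fin n) ℝ := (Matrix.mem_orthogonalGroup_iff' _ _).mpr hR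
  have trace_eq : (Mᵀ * R).trace = (Matrix.diagonal d * (Uᵀ * R * V)).trace := by
    rw [hM, Matrix.transpose_mul, Matrix.transpose_mul, Matrix.transpose_transpose,
      Matrix.diagonal_transpose, Matrix.mul_assoc, Matrix.trace_mul_comm]
    simp only [Matrix.mul_assoc]
  rw [trace_eq]
  exact trace_diagonal_mul_le_of_mem_orthogonalGroup hd (mul_mem (mul_mem hU' hR') hV')
end

section
/- Let n be a positive integer. There exist constants C > 0 and δ > 0 such that for every real n×n matrix N with ‖N‖_F ≤ 1 and every σ with 0 < σ < δ, every orthogonal matrix Q minimizing the Frobenius distance to I + σN over O(n) (i.e. ‖Q − (I + σN)‖_F ≤ ‖R − (I + σN)‖_F for all R ∈ O(n)) satisfies ‖Q − (I + σ·(N − Nᵀ)/2)‖_F ≤ C·σ². That is, the symmetric orthogonalization of I + σN equals I + σA + O(σ²), where A = (N−Nᵀ)/2 is the antisymmetric part of N. -/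
open Matrix

open scoped Matrix.Norms.Frobenius in
theorem frobNorm_eq_norm {n : ℕ} (M : Matrix (Fin n) (Fin n) ℝ) : frobNorm M = ‖M‖ := by
  simp [frobNorm, frobenius_norm_def, Real.sqrt_eq_rpow]

theorem frobNorm_sq_eq_trace {n : ℕ} (M : Matrix (Fin n) (Fin n) ℝ) :
    frobNorm M ^ 2 = (Mᵀ * M).trace := by
  rw [frobNorm, Real.sq_sqrt (by positivity), Finset.sum_comm]
  simp [trace, mul_apply, sq]

theorem frobNorm_sub_sq_of_orthogonal {n : ℕ} {R : Matrix (Fin n) (Fin n) ℝ}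
    (hR : Rᵀ * R = 1) (M : Matrix (Fin n) (Fin n) ℝ) :
    frobNorm (R - M) ^ 2 = n - 2 * (Rᵀ * M).trace + (Mᵀ * M).trace := by
  have h : (Mᵀ * R).trace = (Rᵀ * M).trace := by
    rw [← trace_transpose, transpose_mul, transpose_transpose]
  rw [frobNorm_sq_eq_trace, transpose_sub, sub_mul, mul_sub, mul_sub, hR]
  simp only [trace_sub, trace_one, Fintype.card_fin, h]
  ring

/-- A nearest orthogonal matrix to `M` maximizes `R ↦ tr (Rᵀ M)` over the orthogonal group. -/
theorem trace_le_of_nearest_orthogonal {n : ℕ} {Q M : Matrix (Fin n) (Fin n) ℝ}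
    (hQ : Qᵀ * Q = 1)
    (hmin : ∀ R : Matrix (Fin n) (Fin n) ℝ, Rᵀ * R = 1 → frobNorm (Q - M) ≤ frobNorm (R - M))
    {R : Matrix (Fin n) (Fin n) ℝ} (hR : Rᵀ * R = 1) :
    (Rᵀ * M).trace ≤ (Qᵀ * M).trace := by
  have hnonneg : 0 ≤ frobNorm (Q - M) := Real.sqrt_nonneg _
  have h := pow_le_pow_left₀ hnonneg (hmin R hR) 2
  rw [frobNorm_sub_sq_of_orthogonal hQ, frobNorm_sub_sq_of_orthogonal hR] at h
  linarith

/-- Rodrigues' formula: if `K` is skew-symmetric with `K³ = -K`, then `1 + s K + d K²` is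
orthogonal whenever `(1 - d)² + s² = 1`. -/
theorem rodrigues_orthogonal {n : ℕ} {K : Matrix (Fin n) (Fin n) ℝ} (hK : Kᵀ = -K)
    (hK3 : K * K * K = -K) {s d : ℝ} (h : 2 * d - d ^ 2 - s ^ 2 = 0) :
    (1 + s • K + d • (K * K))ᵀ * (1 + s • K + d • (K * K)) = 1 := by
  have hK3' : K * (K * K) = -K := by rw [← mul_assoc, hK3]
  have key : (1 + s • K + d • (K * K))ᵀ * (1 + s • K + d • (K * K)) =
      1 + (2 * d - d ^ 2 - s ^ 2) • (K * K) := by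
    simp only [transpose_add, transpose_one, transpose_smul, transpose_mul, hK, neg_mul,
      add_mul, mul_add, one_mul, mul_one, smul_mul_assoc, mul_smul_comm, mul_assoc, hK3',
      mul_neg, neg_neg]
    module
  rw [key, h, zero_smul, add_zero]

/-- If the trace of `Uᵀ S` over orthogonal `U` is maximal at the identity, `S` is symmetric. -/
theorem transpose_eq_of_trace_le {n : ℕ} {S : Matrix (Fin n) (Fin n) ℝ}
    (hS : ∀ U : Matrix (Fin n) (Fin n) ℝ, Uᵀ * U = 1 → (Uᵀ * S).trace ≤ S.trace) :
    Sᵀ = S := by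
  ext i j
  rw [transpose_apply]
  by_cases hij : i = j
  · rw [hij]
  set K : Matrix (Fin n) (Fin n) ℝ := single i j 1 - single j i 1 with hKdef
  have hK : Kᵀ = -K := by simp [hKdef]
  have hK2 : K * K = -(single i i 1 + single j j 1) := by
    simp [hKdef, sub_mul, mul_sub, hij, Ne.symm hij]
    abel
  have hK3 : K * K * K = -K := by
    rw [hK2]
    simp [hKdef, add_mul, mul_sub, hij, Ne.symm hij]
    abel
  set a := S i i + S j j
  set b := S i j - S j i with hb
  have htr : (K * S).trace = -b := by
    simp [hKdef, sub_mul, trace_sub, trace_single_mul, hb]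
  have htr2 : (K * K * S).trace = -a := by
    simp [hK2, add_mul, trace_add, trace_single_mul, a, add_comm]
  have hineq (t : ℝ) : t * b ≤ t ^ 2 * a := by
    have ht : 0 < 1 + t ^ 2 := by positivity
    have h := hS _ (rodrigues_orthogonal hK hK3
      (s := 2 * t / (1 + t ^ 2)) (d := 2 * t ^ 2 / (1 + t ^ 2)) (by field_simp; ring))
    simp only [transpose_add, transpose_one, transpose_smul, transpose_mul, hK, neg_mul,
      add_mul, one_mul, smul_mul_assoc, mul_neg, neg_neg, trace_add, trace_smul, trace_neg, htr, htr2,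
      smul_eq_mul] at h
    have h' : 2 * t / (1 + t ^ 2) * b ≤ 2 * t ^ 2 / (1 + t ^ 2) * a := by linarith
    rw [div_mul_eq_mul_div, div_mul_eq_mul_div, div_le_div_iff_of_pos_right ht] at h'
    linarith
  have hpos : 0 < |a| + 1 := by positivity
  have h := hineq (b / (|a| + 1))
  have h' : b ^ 2 * (|a| + 1) ≤ b ^ 2 * a := by
    have h2 := mul_le_mul_of_nonneg_right h (sq_nonneg (|a| + 1))
    field_simp at h2
    linarith
  have hb0 : b ^ 2 ≤ 0 := by nlinarith [mul_le_mul_of_nonneg_left (le_abs_self a) (sq_nonneg b)]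
  have : b = 0 := by simpa using le_antisymm hb0 (sq_nonneg b)
  linarith

/-- First-order optimality: if `Q` is a nearest orthogonal matrix to `M`, then `Qᵀ M` is
symmetric. -/
theorem transpose_mul_eq_of_nearest_orthogonal {n : ℕ} {Q M : Matrix (Fin n) (Fin n) ℝ}
    (hQ : Qᵀ * Q = 1)
    (hmin : ∀ R : Matrix (Fin n) (Fin n) ℝ, Rᵀ * R = 1 → frobNorm (Q - M) ≤ frobNorm (R - M)) :
    Mᵀ * Q = Qᵀ * M := by
  have h : (Qᵀ * M)ᵀ = Qᵀ * M := by
    refine transpose_eq_of_trace_le fun U hU => ?_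
    have hQU : (Q * U)ᵀ * (Q * U) = 1 := by
      rw [transpose_mul, mul_assoc, ← mul_assoc Qᵀ, hQ, one_mul, hU]
    have := trace_le_of_nearest_orthogonal hQ hmin hQU
    rwa [transpose_mul, mul_assoc] at this
  rwa [transpose_mul, transpose_transpose] at h

open scoped Matrix.Norms.Frobenius in
/-- **First-order expansion of symmetric (SVD) orthogonalization.** There are
`C > 0` and `δ > 0` such that for every `N` with `‖N‖_F ≤ 1` and every
`0 < σ < δ`, every orthogonal `Q` nearest to `I + σN` in Frobenius norm
satisfies `‖Q − (I + σ(N − Nᵀ)/2)‖_F ≤ C σ²`; i.e.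
`SVDO(I + σN) = I + σA + O(σ²)` with `A = (N − Nᵀ)/2`. -/
theorem svd_orthogonalization_first_order (n : ℕ) (hn : 0 < n) :
    ∃ C > (0 : ℝ), ∃ δ > (0 : ℝ),
      ∀ N : Matrix (Fin n) (Fin n) ℝ, frobNorm N ≤ 1 →
        ∀ σ : ℝ, 0 < σ → σ < δ →
          ∀ Q : Matrix (Fin n) (Fin n) ℝ, Qᵀ * Q = 1 →
            (∀ R : Matrix (Fin n) (Fin n) ℝ, Rᵀ * R = 1 →
                frobNorm (Q - (1 + σ • N)) ≤ frobNorm (R - (1 + σ • N))) →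
            frobNorm (Q - (1 + (σ / 2) • (N - Nᵀ))) ≤ C * σ ^ 2 := by
  refine ⟨4, by norm_num, 1, by norm_num, fun N hN σ hσ _ Q hQ hmin => ?_⟩
  have hsymm := transpose_mul_eq_of_nearest_orthogonal hQ hmin
  have hone := hmin 1 (by simp)
  rw [frobNorm_eq_norm] at hN ⊢
  rw [frobNorm_eq_norm, frobNorm_eq_norm] at hone
  obtain ⟨E, rfl⟩ : ∃ E, Q = 1 + E := ⟨Q - 1, by abel⟩
  have hσN : ‖σ • N‖ ≤ σ := by
    rw [norm_smul, Real.norm_of_nonneg hσ.le]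
    nlinarith
  have hE : ‖E‖ ≤ 2 * σ := by
    have h1 : (1 : Matrix (Fin n) (Fin n) ℝ) - (1 + σ • N) = -(σ • N) := by abel
    rw [h1, norm_neg] at hone
    calc ‖E‖ = ‖(1 + E - (1 + σ • N)) + σ • N‖ := by congr 1; abel
      _ ≤ ‖1 + E - (1 + σ • N)‖ + ‖σ • N‖ := norm_add_le _ _
      _ ≤ 2 * σ := by linarith
  have hEt : ‖Eᵀ‖ = ‖E‖ := frobenius_norm_transpose E
  have hNt : ‖Nᵀ‖ = ‖N‖ := frobenius_norm_transpose N
  have hEE : ‖Eᵀ * E‖ ≤ 4 * σ ^ 2 := by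
    have := frobenius_norm_mul Eᵀ E
    rw [hEt] at this
    nlinarith [norm_nonneg E]
  have hEN : ‖Eᵀ * N‖ ≤ 2 * σ := by
    have := frobenius_norm_mul Eᵀ N
    rw [hEt] at this
    nlinarith [norm_nonneg E, norm_nonneg N]
  have hNE : ‖Nᵀ * E‖ ≤ 2 * σ := by
    have := frobenius_norm_mul Nᵀ E
    rw [hNt] at this
    nlinarith [norm_nonneg E, norm_nonneg N]
  have key : 1 + E - (1 + (σ / 2) • (N - Nᵀ)) =
      (σ / 2) • (Eᵀ * N - Nᵀ * E) - (1 / 2 : ℝ) • (Eᵀ * E) := by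
    simp only [transpose_add, transpose_one, transpose_smul, add_mul, mul_add, one_mul, mul_one,
      smul_mul_assoc, mul_smul_comm] at hQ hsymm
    linear_combination (norm := module) (1 / 2 : ℝ) • hQ + (1 / 2 : ℝ) • hsymm
  have hdiff : ‖Eᵀ * N - Nᵀ * E‖ ≤ 4 * σ := (norm_sub_le _ _).trans (by linarith)
  rw [key]
  calc _ ≤ ‖(σ / 2) • (Eᵀ * N - Nᵀ * E)‖ + ‖(1 / 2 : ℝ) • (Eᵀ * E)‖ := norm_sub_le _ _
    _ = σ / 2 * ‖Eᵀ * N - Nᵀ * E‖ + 1 / 2 * ‖Eᵀ * E‖ := by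
      rw [norm_smul, norm_smul, Real.norm_of_nonneg (by positivity),
        Real.norm_of_nonneg (by positivity)]
    _ ≤ σ / 2 * (4 * σ) + 1 / 2 * (4 * σ ^ 2) := by gcongr
    _ = 4 * σ ^ 2 := by ring
end

section
/- Let n be a positive integer and let M be a real n×n matrix with det(M) > 0. Then every orthogonal matrix Q minimizing the Frobenius distance to M over O(n) (i.e. satisfying ‖Q − M‖_F ≤ ‖R − M‖_F for all R ∈ O(n)) has determinant 1, i.e. lies in the special orthogonal group SO(n). Consequently, for such M the nearest orthogonal matrix and the nearest rotation matrix coincide. -/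
open Matrix

/-- A real matrix with nonnegative quadratic form has nonnegative determinant. -/
lemma Matrix.det_nonneg_of_dotProduct_mulVec_nonneg {ι : Type*} [Fintype ι] [DecidableEq ι]
    (A : Matrix ι ι ℝ) (hA : ∀ v, 0 ≤ v ⬝ᵥ (A *ᵥ v)) : 0 ≤ A.det := by
  by_contra! hneg
  let f : ℝ → ℝ := fun t => ((1 - t) • A + t • (1 : Matrix ι ι ℝ)).det
  have hf : ContinuousOn f (Set.Icc 0 1) :=
    Continuous.continuousOn (Continuous.matrix_det (by fun_prop))
  obtain ⟨t, ⟨ht0, ht1⟩, ht⟩ := intermediate_value_Icc zero_le_one hf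
    (show (0 : ℝ) ∈ Set.Icc (f 0) (f 1) by simp [f, hneg.le])
  have htpos : 0 < t := by
    refine lt_of_le_of_ne ht0 fun h => ?_
    subst h
    simp [f] at ht
    exact hneg.ne ht
  obtain ⟨v, hv, hv0⟩ := Matrix.exists_mulVec_eq_zero_iff.mpr ht
  have hform : (1 - t) * (v ⬝ᵥ (A *ᵥ v)) + t * (v ⬝ᵥ v) = 0 := by
    have := congrArg (v ⬝ᵥ ·) hv0
    simpa [Matrix.add_mulVec, Matrix.smul_mulVec, dotProduct_add] using this
  have hvpos : 0 < v ⬝ᵥ v := by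
    simpa using Matrix.dotProduct_star_self_pos_iff.mpr hv
  have h1 : 0 ≤ (1 - t) * (v ⬝ᵥ (A *ᵥ v)) := mul_nonneg (by linarith) (hA v)
  have h2 : 0 < t * (v ⬝ᵥ v) := mul_pos htpos hvpos
  linarith

lemma sum_sq_eq_trace {n : ℕ} (M : Matrix (Fin n) (Fin n) ℝ) :
    ∑ i, ∑ j, (M i j) ^ 2 = (Mᵀ * M).trace := by
  rw [Finset.sum_comm]
  simp [Matrix.trace, Matrix.mul_apply, sq]

lemma trace_sub_of_orthogonal {n : ℕ} (R M : Matrix (Fin n) (Fin n) ℝ) (hR : Rᵀ * R = 1) :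
    ((R - M)ᵀ * (R - M)).trace = n - 2 * (Rᵀ * M).trace + (Mᵀ * M).trace := by
  have hsymm : (Mᵀ * R).trace = (Rᵀ * M).trace := by
    rw [← Matrix.trace_transpose, Matrix.transpose_mul, Matrix.transpose_transpose]
  simp only [Matrix.transpose_sub, Matrix.sub_mul, Matrix.mul_sub, Matrix.trace_sub, hR, hsymm,
    Matrix.trace_one, Fintype.card_fin]
  ring

/-- Among orthogonal matrices, decreasing the Frobenius distance to `M` is the same as
increasing the trace pairing with `M`. -/
lemma trace_le_of_frobNorm_le {n : ℕ} {Q R M : Matrix (Fin n) (Fin n) ℝ}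
    (hQ : Qᵀ * Q = 1) (hR : Rᵀ * R = 1) (h : frobNorm (Q - M) ≤ frobNorm (R - M)) :
    (Rᵀ * M).trace ≤ (Qᵀ * M).trace := by
  have hnonneg : 0 ≤ ∑ i, ∑ j, ((R - M) i j) ^ 2 := by positivity
  have hsq := (Real.sqrt_le_sqrt_iff hnonneg).mp h
  rw [sum_sq_eq_trace, sum_sq_eq_trace, trace_sub_of_orthogonal Q M hQ,
    trace_sub_of_orthogonal R M hR] at hsq
  linarith

/-- The quadratic form of `Qᵀ * M` is nonnegative for a nearest orthogonal matrix `Q`: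
compare `Q` with its composition with the Householder reflection along `v`. -/
lemma dotProduct_mulVec_nonneg_of_nearest {n : ℕ} {Q M : Matrix (Fin n) (Fin n) ℝ}
    (hQ : Qᵀ * Q = 1)
    (hmin : ∀ R : Matrix (Fin n) (Fin n) ℝ, Rᵀ * R = 1 →
      frobNorm (Q - M) ≤ frobNorm (R - M)) (v : Fin n → ℝ) :
    0 ≤ v ⬝ᵥ ((Qᵀ * M) *ᵥ v) := by
  rcases eq_or_ne v 0 with rfl | hv
  · simp
  have hvpos : 0 < v ⬝ᵥ v := by
    simpa using Matrix.dotProduct_star_self_pos_iff.mpr hv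
  set c : ℝ := 2 / (v ⬝ᵥ v) with hc
  have hcpos : 0 < c := by positivity
  have hcv : c * (v ⬝ᵥ v) = 2 := by rw [hc]; field_simp
  set S : Matrix (Fin n) (Fin n) ℝ := 1 - c • vecMulVec v v with hS
  have hST : Sᵀ = S := by simp [hS, Matrix.transpose_vecMulVec]
  have hSS : S * S = 1 := by
    have hvv : (c • vecMulVec v v) * (c • vecMulVec v v) = (2 : ℝ) • (c • vecMulVec v v) := by
      rw [Matrix.smul_mul, Matrix.mul_smul, Matrix.vecMulVec_mul_vecMulVec, ← hcv]
      ext i j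
      simp [vecMulVec_apply]
      ring
    rw [hS, Matrix.sub_mul, Matrix.mul_sub, Matrix.mul_sub, hvv, two_smul]
    simp
  have hR : (Q * S)ᵀ * (Q * S) = 1 := by
    rw [Matrix.transpose_mul, hST, Matrix.mul_assoc, ← Matrix.mul_assoc Qᵀ, hQ, Matrix.one_mul, hSS]
  have htr := trace_le_of_frobNorm_le hQ hR (hmin _ hR)
  rw [Matrix.transpose_mul, hST, Matrix.mul_assoc, hS, Matrix.sub_mul, Matrix.one_mul,
    Matrix.trace_sub, Matrix.smul_mul, Matrix.trace_smul, Matrix.trace_mul_comm (vecMulVec v v),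
    Matrix.mul_vecMulVec, Matrix.trace_vecMulVec, dotProduct_comm, smul_eq_mul] at htr
  exact nonneg_of_mul_nonneg_right (by linarith) hcpos

/-- **For `det M > 0`, the nearest orthogonal matrix is a rotation.** If
`det M > 0` and `Q` is an orthogonal matrix minimizing the Frobenius distance
to `M` over `O(n)`, then `det Q = 1`, i.e. `Q ∈ SO(n)`. -/
theorem nearest_orthogonal_is_rotation (n : ℕ) (hn : 0 < n)
    (M : Matrix (Fin n) (Fin n) ℝ) (hdet : 0 < M.det)
    (Q : Matrix (Fin n) (Fin n) ℝ) (hQ : Qᵀ * Q = 1)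
    (hmin : ∀ R : Matrix (Fin n) (Fin n) ℝ, Rᵀ * R = 1 →
      frobNorm (Q - M) ≤ frobNorm (R - M)) :
    Q.det = 1 := by
  have hA := Matrix.det_nonneg_of_dotProduct_mulVec_nonneg _
    (dotProduct_mulVec_nonneg_of_nearest hQ hmin)
  rw [Matrix.det_mul, Matrix.det_transpose] at hA
  have hQnonneg : 0 ≤ Q.det := nonneg_of_mul_nonneg_left hA hdet
  have hQsq : Q.det * Q.det = 1 := by
    simpa [Matrix.det_mul] using congrArg Matrix.det hQ
  nlinarith
end
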